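/- Let D ≥ 1, let x : U → V be a C³ diffeomorphism between open subsets of ℝ^D with inverse ξ, Jacobi matrix 𝒥(ζ)_{iα} = ∂x^i/∂ζ^α and J = det 𝒥. Let a^{kj}, v^i : V → ℝ be C² and C¹ and let φ : V × ℝ → ℝ be C² and satisfy the convection-diffusion equation ∂φ/∂t + Σ_i ∂/∂x^i(v^i φ) = Σ_{k,j} ∂/∂x^k(a^{kj} ∂φ/∂x^j) on V × ℝ. Define ψ(ζ,t) = J(ζ) φ(x(ζ), t), ã^{kβ}(ζ) = Σ_{α,j} a^{αj}(x(ζ)) (𝒥⁻¹)_{kα}(𝒥⁻¹)_{βj}, and ṽ^{k}(ζ) = Σ_i v^i(x(ζ)) (𝒥⁻¹)_{ki} + Σ_{α,j,β,γ,ρ} a^{αj}(x(ζ)) (𝒥⁻¹)_{kα}(𝒥⁻¹)_{βj}(𝒥⁻¹)_{γρ} ∂²x^ρ/∂ζ^γ∂ζ^β. Then ψ satisfies ∂ψ/∂t + Σ_k ∂/∂ζ^k(ṽ^k ψ) = Σ_{k,β} ∂/∂ζ^k(ã^{kβ} ∂ψ/∂ζ^β) on U × ℝ. Moreover, if φ(·,0)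 = f then ψ(ζ,0) = J(ζ) f(x(ζ)). -/

import Mathlib

open scoped BigOperators

/-- Partial derivative of `f` at `p` in the direction of the `i`-th standard basis vector. -/
noncomputable def pd {D : ℕ} (f : (Fin D → ℝ) → ℝ) (p : Fin D → ℝ) (i : Fin D) : ℝ :=
  fderiv ℝ f p (Pi.single i 1)

/-- Second partial derivative: `∂_i ∂_j f`. -/
noncomputable def pd2 {D : ℕ} (f : (Fin D → ℝ) → ℝ) (p : Fin D → ℝ) (i j : Fin D) : ℝ :=
  pd (fun q => pd f q j) p i

/-- Jacobi matrix `𝒥(ζ)_{iα} = ∂x^i/∂ζ^α`. -/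
noncomputable def jacobi {D : ℕ} (x : (Fin D → ℝ) → (Fin D → ℝ)) (ζ : Fin D → ℝ) :
    Matrix (Fin D) (Fin D) ℝ :=
  Matrix.of fun i α => pd (fun z => x z i) ζ α

/-- Jacobian determinant `J(ζ) = det 𝒥(ζ)`. -/
noncomputable def jdet {D : ℕ} (x : (Fin D → ℝ) → (Fin D → ℝ)) (ζ : Fin D → ℝ) : ℝ :=
  (jacobi x ζ).det

section PartialDerivatives

variable {D : ℕ}

lemma pd_congr {f g : (Fin D → ℝ) → ℝ} {U : Set (Fin D → ℝ)} (hU : IsOpen U)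
    (h : ∀ z ∈ U, f z = g z) {p : Fin D → ℝ} (hp : p ∈ U) (i : Fin D) : pd f p i = pd g p i := by
  have : f =ᶠ[nhds p] g := Filter.eventuallyEq_of_mem (hU.mem_nhds hp) h
  rw [pd, pd, this.fderiv_eq]

lemma pd_mul {f g : (Fin D → ℝ) → ℝ} {p : Fin D → ℝ} (hf : DifferentiableAt ℝ f p)
    (hg : DifferentiableAt ℝ g p) (i : Fin D) :
    pd (fun z => f z * g z) p i = pd f p i * g p + f p * pd g p i := by
  simp only [pd]
  rw [fderiv_fun_mul hf hg]
  simp only [add_apply, smul_apply, smul_eq_mul]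
  ring

lemma pd_sub {f g : (Fin D → ℝ) → ℝ} {p : Fin D → ℝ} (hf : DifferentiableAt ℝ f p)
    (hg : DifferentiableAt ℝ g p) (i : Fin D) :
    pd (fun z => f z - g z) p i = pd f p i - pd g p i := by
  simp only [pd]
  rw [fderiv_fun_sub hf hg]
  simp

lemma pd_sum {ι : Type*} {s : Finset ι} {f : ι → (Fin D → ℝ) → ℝ} {p : Fin D → ℝ}
    (hf : ∀ j ∈ s, DifferentiableAt ℝ (f j) p) (i : Fin D) :
    pd (fun z => ∑ j ∈ s, f j z) p i = ∑ j ∈ s, pd (f j) p i := by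
  simp only [pd]
  rw [fderiv_fun_sum hf]
  simp

lemma pd_comp {g : (Fin D → ℝ) → ℝ} {x : (Fin D → ℝ) → (Fin D → ℝ)} {p : Fin D → ℝ}
    (hg : DifferentiableAt ℝ g (x p)) (hx : DifferentiableAt ℝ x p) (k : Fin D) :
    pd (fun z => g (x z)) p k = ∑ i, pd g (x p) i * jacobi x p i k := by
  have h1 : fderiv ℝ (fun z => g (x z)) p = (fderiv ℝ g (x p)).comp (fderiv ℝ x p) :=
    fderiv_comp p hg hx
  have h2 : ∀ i, jacobi x p i k = fderiv ℝ x p (Pi.single k 1) i := fun i => by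
    simp only [jacobi, Matrix.of_apply, pd]
    rw [fderiv_apply (𝕜 := ℝ) hx i]
    rfl
  have h3 : fderiv ℝ x p (Pi.single k 1) =
      ∑ i, (fderiv ℝ x p (Pi.single k 1) i) • (Pi.single i (1 : ℝ) : Fin D → ℝ) :=
    pi_eq_sum_univ' _
  rw [pd, h1, ContinuousLinearMap.comp_apply, h3, map_sum]
  refine Finset.sum_congr rfl fun i _ => ?_
  rw [map_smul, smul_eq_mul, h2, mul_comm, pd]

lemma contDiffOn_pd {f : (Fin D → ℝ) → ℝ} {U : Set (Fin D → ℝ)} (hU : IsOpen U)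
    {m n : WithTop ℕ∞} (hf : ContDiffOn ℝ n f U) (hmn : m + 1 ≤ n) (i : Fin D) :
    ContDiffOn ℝ m (fun z => pd f z i) U :=
  (hf.fderiv_of_isOpen hU hmn).clm_apply contDiffOn_const

lemma pd2_comm {f : (Fin D → ℝ) → ℝ} {U : Set (Fin D → ℝ)} (hU : IsOpen U)
    (hf : ContDiffOn ℝ 2 f U) {p : Fin D → ℝ} (hp : p ∈ U) (i j : Fin D) :
    pd2 f p i j = pd2 f p j i := by
  have hd : DifferentiableAt ℝ (fderiv ℝ f) p :=
    ((hf.fderiv_of_isOpen (m := 1) hU (by norm_num)).contDiffAt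
      (hU.mem_nhds hp)).differentiableAt (by norm_num)
  have key : ∀ i j, pd2 f p i j = fderiv ℝ (fderiv ℝ f) p (Pi.single i 1) (Pi.single j 1) := by
    intro i j
    simp only [pd2, pd]
    rw [fderiv_clm_apply hd (differentiableAt_const _)]
    simp
  rw [key, key]
  exact (hf.contDiffAt (hU.mem_nhds hp)).isSymmSndFDerivAt (by simp) _ _

end PartialDerivatives

section Determinant

variable {D : ℕ}

lemma det_updateRow_eq_sum_inv {M : Matrix (Fin D) (Fin D) ℝ} (hM : M.det ≠ 0) (i : Fin D)
    (b : Fin D → ℝ) : (M.updateRow i b).det = M.det * ∑ j, M⁻¹ j i * b j := by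
  rw [← Matrix.cramer_transpose_apply, Matrix.cramer_eq_adjugate_mulVec,
    Matrix.mulVec, dotProduct, Finset.mul_sum]
  refine Finset.sum_congr rfl fun j _ => ?_
  rw [Matrix.inv_def, Ring.inverse_eq_inv', ← Matrix.adjugate_transpose]
  simp only [Matrix.transpose_apply, Matrix.smul_apply, smul_eq_mul]
  field_simp

lemma pd_det {M : (Fin D → ℝ) → Matrix (Fin D) (Fin D) ℝ} {p : Fin D → ℝ}
    (hM : ∀ i j, DifferentiableAt ℝ (fun z => M z i j) p) (h0 : (M p).det ≠ 0) (k : Fin D) :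
    pd (fun z => (M z).det) p k =
      (M p).det * ∑ i, ∑ j, (M p)⁻¹ j i * pd (fun z => M z i j) p k := by
  let d : ContinuousMultilinearMap ℝ (fun _ : Fin D => Fin D → ℝ) ℝ :=
    { Matrix.detRowAlternating.toMultilinearMap with
      cont := (continuous_id (X := Matrix (Fin D) (Fin D) ℝ)).matrix_det }
  let N : (Fin D → ℝ) → (Fin D → Fin D → ℝ) := fun z i j => M z i j
  have hN : HasFDerivAt N (ContinuousLinearMap.pi fun i => ContinuousLinearMap.pi fun j =>
      fderiv ℝ (fun z => M z i j) p) p :=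
    hasFDerivAt_pi.2 fun i => hasFDerivAt_pi.2 fun j => (hM i j).hasFDerivAt
  have h := (d.hasFDerivAt (N p)).comp p hN
  have h' : fderiv ℝ (fun z => (M z).det) p = _ := h.fderiv
  rw [pd, h', ContinuousLinearMap.comp_apply, ContinuousMultilinearMap.linearDeriv_apply,
    Finset.mul_sum]
  refine Finset.sum_congr rfl fun i _ => ?_
  exact det_updateRow_eq_sum_inv h0 i _

end Determinant

section Diffeomorphism

variable {D : ℕ} {U V : Set (Fin D → ℝ)} {x ξ : (Fin D → ℝ) → (Fin D → ℝ)}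

lemma jacobi_mul_jacobi (hU : IsOpen U) (hV : IsOpen V) (hxmaps : Set.MapsTo x U V)
    (hleft : ∀ ζ ∈ U, ξ (x ζ) = ζ) (hx : DifferentiableOn ℝ x U) (hξ : DifferentiableOn ℝ ξ V)
    {ζ : Fin D → ℝ} (hζ : ζ ∈ U) : jacobi ξ (x ζ) * jacobi x ζ = 1 := by
  ext i k
  have hdξ := hξ.differentiableAt (hV.mem_nhds (hxmaps hζ))
  have hdx := hx.differentiableAt (hU.mem_nhds hζ)
  have h1 := pd_comp (g := fun q => ξ q i) (differentiableAt_pi.1 hdξ i) hdx k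
  rw [pd_congr hU (g := fun z => z i) (fun z hz => by rw [hleft z hz]) hζ] at h1
  rw [Matrix.mul_apply]
  refine h1.symm.trans ?_
  rw [pd, fderiv_apply (𝕜 := ℝ) differentiableAt_id i]
  simp [Matrix.one_apply, Pi.single_apply]

lemma contDiffOn_jacobi (hU : IsOpen U) (hx : ContDiffOn ℝ 3 x U) (i α : Fin D) :
    ContDiffOn ℝ 2 (fun z => jacobi x z i α) U :=
  contDiffOn_pd hU (contDiffOn_pi.1 hx i) (by norm_num) α

lemma contDiffOn_jdet (hU : IsOpen U) (hx : ContDiffOn ℝ 3 x U) :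
    ContDiffOn ℝ 2 (jdet x) U := by
  have : jdet x = fun z => ∑ σ : Equiv.Perm (Fin D),
      ((Equiv.Perm.sign σ : ℤ) : ℝ) * ∏ i, jacobi x z (σ i) i := by
    ext z; rw [jdet, Matrix.det_apply']
  rw [this]
  exact ContDiffOn.sum fun σ _ => contDiffOn_const.mul
    (contDiffOn_prod fun i _ => contDiffOn_jacobi hU hx _ _)

lemma pd_jdet (hU : IsOpen U) (hx : ContDiffOn ℝ 3 x U) {ζ : Fin D → ℝ} (hζ : ζ ∈ U)
    (h0 : jdet x ζ ≠ 0) (k : Fin D) :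
    pd (jdet x) ζ k =
      jdet x ζ * ∑ γ, ∑ ρ, (jacobi x ζ)⁻¹ γ ρ * pd2 (fun z => x z ρ) ζ γ k := by
  rw [Finset.sum_comm]
  refine (pd_det (M := jacobi x) (fun i j => ((contDiffOn_jacobi hU hx i j).contDiffAt
    (hU.mem_nhds hζ)).differentiableAt (by norm_num)) h0 k).trans ?_
  refine congrArg _ (Finset.sum_congr rfl fun ρ _ => Finset.sum_congr rfl fun γ _ => ?_)
  rw [pd2_comm hU ((contDiffOn_pi.1 hx ρ).of_le (by norm_num)) hζ]
  rfl

lemma pd_inv_jacobi (hU : IsOpen U) (hx : ContDiffOn ℝ 3 x U)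
    (hB : ∀ k α, ContDiffOn ℝ 2 (fun z => (jacobi x z)⁻¹ k α) U)
    (h0 : ∀ z ∈ U, jdet x z ≠ 0) {ζ : Fin D → ℝ} (hζ : ζ ∈ U) (i α k : Fin D) :
    pd (fun z => (jacobi x z)⁻¹ i α) ζ k =
      -∑ γ, ∑ ρ, (jacobi x ζ)⁻¹ i ρ * pd2 (fun z => x z ρ) ζ γ k * (jacobi x ζ)⁻¹ γ α := by
  have hdA : ∀ i j, DifferentiableAt ℝ (fun z => jacobi x z i j) ζ := fun i j =>
    ((contDiffOn_jacobi hU hx i j).contDiffAt (hU.mem_nhds hζ)).differentiableAt (by norm_num)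
  have hdB : ∀ i j, DifferentiableAt ℝ (fun z => (jacobi x z)⁻¹ i j) ζ := fun i j =>
    ((hB i j).contDiffAt (hU.mem_nhds hζ)).differentiableAt (by norm_num)
  let A' : Matrix (Fin D) (Fin D) ℝ := Matrix.of fun i j => pd (fun z => jacobi x z i j) ζ k
  let B' : Matrix (Fin D) (Fin D) ℝ := Matrix.of fun i j => pd (fun z => (jacobi x z)⁻¹ i j) ζ k
  have hu : ∀ z ∈ U, IsUnit (jacobi x z).det := fun z hz => isUnit_iff_ne_zero.2 (h0 z hz)
  have hprod : B' * jacobi x ζ + (jacobi x ζ)⁻¹ * A' = 0 := by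
    ext i j
    have h1 : pd (fun z => ∑ l, (jacobi x z)⁻¹ i l * jacobi x z l j) ζ k = 0 := by
      rw [pd_congr hU (g := fun _ => (1 : Matrix (Fin D) (Fin D) ℝ) i j) (fun z hz => by
        rw [← Matrix.mul_apply, Matrix.nonsing_inv_mul _ (hu z hz)]) hζ]
      simp [pd]
    rw [pd_sum fun l _ => (hdB i l).fun_mul (hdA l j)] at h1
    simp_rw [pd_mul (hdB i _) (hdA _ j), Finset.sum_add_distrib] at h1
    simpa [Matrix.mul_apply, A', B'] using h1
  have hB' : B' = -((jacobi x ζ)⁻¹ * A' * (jacobi x ζ)⁻¹) := by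
    have := congrArg (· * (jacobi x ζ)⁻¹) hprod
    simp only [add_mul, zero_mul, Matrix.mul_assoc, Matrix.mul_nonsing_inv _ (hu ζ hζ),
      mul_one] at this
    rw [Matrix.mul_assoc]
    exact eq_neg_of_add_eq_zero_left this
  have h2 := congrFun (congrFun hB' i) α
  refine h2.trans ?_
  simp only [Matrix.neg_apply, Matrix.mul_apply, Finset.sum_mul]
  refine congrArg _ (Finset.sum_congr rfl fun γ _ => Finset.sum_congr rfl fun ρ _ => ?_)
  rw [pd2_comm hU ((contDiffOn_pi.1 hx ρ).of_le (by norm_num)) hζ]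
  rfl

/-- The Piola identity. -/
lemma sum_pd_jdet_mul_inv_jacobi (hU : IsOpen U) (hx : ContDiffOn ℝ 3 x U)
    (hB : ∀ k α, ContDiffOn ℝ 2 (fun z => (jacobi x z)⁻¹ k α) U)
    (h0 : ∀ z ∈ U, jdet x z ≠ 0) {ζ : Fin D → ℝ} (hζ : ζ ∈ U) (α : Fin D) :
    ∑ k, pd (fun z => jdet x z * (jacobi x z)⁻¹ k α) ζ k = 0 := by
  have hdJ : DifferentiableAt ℝ (jdet x) ζ :=
    ((contDiffOn_jdet hU hx).contDiffAt (hU.mem_nhds hζ)).differentiableAt (by norm_num)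
  have hdB : ∀ i j, DifferentiableAt ℝ (fun z => (jacobi x z)⁻¹ i j) ζ := fun i j =>
    ((hB i j).contDiffAt (hU.mem_nhds hζ)).differentiableAt (by norm_num)
  simp_rw [pd_mul hdJ (hdB _ α), pd_jdet hU hx hζ (h0 ζ hζ), pd_inv_jacobi hU hx hB h0 hζ,
    Finset.sum_add_distrib, mul_neg, Finset.sum_neg_distrib]
  rw [← sub_eq_add_neg, sub_eq_zero]
  simp only [Finset.mul_sum, Finset.sum_mul]
  rw [Finset.sum_comm]
  refine Finset.sum_congr rfl fun γ _ => Finset.sum_congr rfl fun k _ =>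
    Finset.sum_congr rfl fun ρ _ => ?_
  rw [pd2_comm hU ((contDiffOn_pi.1 hx ρ).of_le (by norm_num)) hζ]
  ring

/-- The Piola transform of a vector field multiplies its divergence by the Jacobian. -/
lemma sum_pd_piola_transform (hU : IsOpen U) (hx : ContDiffOn ℝ 3 x U)
    (hB : ∀ k α, ContDiffOn ℝ 2 (fun z => (jacobi x z)⁻¹ k α) U)
    (h0 : ∀ z ∈ U, jdet x z ≠ 0) {ζ : Fin D → ℝ} (hζ : ζ ∈ U)
    {F : Fin D → (Fin D → ℝ) → ℝ} (hF : ∀ α, DifferentiableAt ℝ (F α) (x ζ)) :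
    ∑ k, pd (fun z => ∑ α, jdet x z * (jacobi x z)⁻¹ k α * F α (x z)) ζ k =
      jdet x ζ * ∑ α, pd (F α) (x ζ) α := by
  have hdx : DifferentiableAt ℝ x ζ :=
    (hx.contDiffAt (hU.mem_nhds hζ)).differentiableAt (by norm_num)
  have hdJB : ∀ k α, DifferentiableAt ℝ (fun z => jdet x z * (jacobi x z)⁻¹ k α) ζ := fun k α =>
    (((contDiffOn_jdet hU hx).mul (hB k α)).contDiffAt
      (hU.mem_nhds hζ)).differentiableAt (by norm_num)
  have hdF : ∀ α, DifferentiableAt ℝ (fun z => F α (x z)) ζ := fun α => (hF α).comp ζ hdx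
  have hu : IsUnit (jacobi x ζ).det := isUnit_iff_ne_zero.2 (h0 ζ hζ)
  simp_rw [pd_sum (fun α _ => (hdJB _ α).fun_mul (hdF α)) _, pd_mul (hdJB _ _) (hdF _),
    Finset.sum_add_distrib]
  rw [Finset.sum_comm]
  simp_rw [← Finset.sum_mul, sum_pd_jdet_mul_inv_jacobi hU hx hB h0 hζ, zero_mul,
    Finset.sum_const_zero, zero_add]
  rw [Finset.sum_comm, Finset.mul_sum]
  refine Finset.sum_congr rfl fun α _ => ?_
  simp_rw [pd_comp (hF α) hdx, Finset.mul_sum]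
  rw [Finset.sum_comm]
  have hone : ∀ i, ∑ k, jdet x ζ * (jacobi x ζ)⁻¹ k α * (pd (F α) (x ζ) i * jacobi x ζ i k) =
      jdet x ζ * pd (F α) (x ζ) i * (1 : Matrix (Fin D) (Fin D) ℝ) i α := fun i => by
    rw [← Matrix.mul_nonsing_inv _ hu, Matrix.mul_apply, Finset.mul_sum]
    exact Finset.sum_congr rfl fun k _ => by ring
  simp_rw [hone, Matrix.one_apply]
  simp

end Diffeomorphism

theorem convection_diffusion_transformation {D : ℕ} (hD : 1 ≤ D)
    (U V : Set (Fin D → ℝ)) (hU : IsOpen U) (hV : IsOpen V)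
    (x ξ : (Fin D → ℝ) → (Fin D → ℝ))
    (hxmaps : Set.MapsTo x U V) (hξmaps : Set.MapsTo ξ V U)
    (hleft : ∀ ζ ∈ U, ξ (x ζ) = ζ) (hright : ∀ p ∈ V, x (ξ p) = p)
    (hx : ContDiffOn ℝ 3 x U) (hξ : ContDiffOn ℝ 3 ξ V)
    (a : Fin D → Fin D → (Fin D → ℝ) → ℝ) (ha : ∀ k j, ContDiffOn ℝ 2 (a k j) V)
    (v : Fin D → (Fin D → ℝ) → ℝ) (hv : ∀ i, ContDiffOn ℝ 1 (v i) V)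
    (φ : (Fin D → ℝ) → ℝ → ℝ)
    (hφ : ContDiffOn ℝ 2 (Function.uncurry φ) (V ×ˢ (Set.univ : Set ℝ)))
    (heq : ∀ p ∈ V, ∀ t : ℝ,
      deriv (φ p) t + ∑ i : Fin D, pd (fun q => v i q * φ q t) p i =
        ∑ k : Fin D, ∑ j : Fin D, pd (fun q => a k j q * pd (fun r => φ r t) q j) p k)
    (ψ : (Fin D → ℝ) → ℝ → ℝ) (hψ : ∀ ζ t, ψ ζ t = jdet x ζ * φ (x ζ) t)
    (ta : Fin D → Fin D → (Fin D → ℝ) → ℝ)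
    (hta : ∀ k β ζ, ta k β ζ =
      ∑ α : Fin D, ∑ j : Fin D, a α j (x ζ) * (jacobi x ζ)⁻¹ k α * (jacobi x ζ)⁻¹ β j)
    (tv : Fin D → (Fin D → ℝ) → ℝ)
    (htv : ∀ k ζ, tv k ζ =
      (∑ i : Fin D, v i (x ζ) * (jacobi x ζ)⁻¹ k i) +
        ∑ α : Fin D, ∑ j : Fin D, ∑ β : Fin D, ∑ γ : Fin D, ∑ ρ : Fin D,
          a α j (x ζ) * (jacobi x ζ)⁻¹ k α * (jacobi x ζ)⁻¹ β j *
            ((jacobi x ζ)⁻¹ γ ρ * pd2 (fun z => x z ρ) ζ γ β)) :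
    (∀ ζ ∈ U, ∀ t : ℝ,
        deriv (ψ ζ) t + ∑ k : Fin D, pd (fun z => tv k z * ψ z t) ζ k =
          ∑ k : Fin D, ∑ β : Fin D, pd (fun z => ta k β z * pd (fun r => ψ r t) z β) ζ k) ∧
      ∀ f : (Fin D → ℝ) → ℝ, (∀ p, φ p 0 = f p) → ∀ ζ, ψ ζ 0 = jdet x ζ * f (x ζ) := by
  refine ⟨fun ζ hζ t => ?_, fun f hf ζ => by rw [hψ, hf]⟩
  have hmul : ∀ z ∈ U, jacobi ξ (x z) * jacobi x z = 1 := fun z hz =>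
    jacobi_mul_jacobi hU hV hxmaps hleft (hx.differentiableOn (by norm_num))
      (hξ.differentiableOn (by norm_num)) hz
  have h0 : ∀ z ∈ U, jdet x z ≠ 0 := fun z hz =>
    (Matrix.isUnit_det_of_left_inverse (hmul z hz)).ne_zero
  have hx2 : ContDiffOn ℝ 2 x U := hx.of_le (by norm_num)
  have hB : ∀ k α, ContDiffOn ℝ 2 (fun z => (jacobi x z)⁻¹ k α) U := fun k α =>
    ((contDiffOn_jacobi hV hξ k α).comp hx2 hxmaps).congr fun z hz => by
      rw [Matrix.inv_eq_left_inv (hmul z hz)]; rfl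
  have hJ := contDiffOn_jdet hU hx
  have hφt : ContDiffOn ℝ 2 (fun q => φ q t) V :=
    hφ.comp (contDiffOn_id.prodMk contDiffOn_const) fun q hq => ⟨hq, trivial⟩
  have hφx : ContDiffOn ℝ 2 (fun z => φ (x z) t) U := hφt.comp hx2 hxmaps
  have hψt : ContDiffOn ℝ 2 (fun z => ψ z t) U :=
    (hJ.mul hφx).congr fun z _ => hψ z t
  have hat : ∀ {W : Set (Fin D → ℝ)} {g : (Fin D → ℝ) → ℝ} {q : Fin D → ℝ}, IsOpen W →
      ContDiffOn ℝ 1 g W → q ∈ W → DifferentiableAt ℝ g q := fun hW hg hq =>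
    (hg.contDiffAt (hW.mem_nhds hq)).differentiableAt (by norm_num)
  have h12 : (1 : WithTop ℕ∞) ≤ 2 := by norm_num
  have hx1 := hx2.of_le h12
  have ha' : ∀ k j, ContDiffOn ℝ 1 (fun z => a k j (x z)) U := fun k j =>
    ((ha k j).of_le h12).comp hx1 hxmaps
  have hv' : ∀ i, ContDiffOn ℝ 1 (fun z => v i (x z)) U := fun i => (hv i).comp hx1 hxmaps
  have hB1 := fun k α => (hB k α).of_le h12
  have hpd2 : ∀ ρ γ β, ContDiffOn ℝ 1 (fun z => pd2 (fun y => x y ρ) z γ β) U := fun ρ γ β =>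
    contDiffOn_pd hU (contDiffOn_jacobi hU hx ρ β) (by norm_num) γ
  have hta1 : ∀ k β, ContDiffOn ℝ 1 (ta k β) U := fun k β => by
    rw [funext (hta k β)]
    exact ContDiffOn.sum fun α _ => ContDiffOn.sum fun j _ =>
      ((ha' α j).mul (hB1 k α)).mul (hB1 β j)
  have htv1 : ∀ k, ContDiffOn ℝ 1 (tv k) U := fun k => by
    rw [funext (htv k)]
    exact (ContDiffOn.sum fun i _ => (hv' i).mul (hB1 k i)).add <|
      ContDiffOn.sum fun α _ => ContDiffOn.sum fun j _ => ContDiffOn.sum fun β _ =>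
        ContDiffOn.sum fun γ _ => ContDiffOn.sum fun ρ _ =>
          (((ha' α j).mul (hB1 k α)).mul (hB1 β j)).mul ((hB1 γ ρ).mul (hpd2 ρ γ β))
  have hdtvψ : ∀ k, DifferentiableAt ℝ (fun z => tv k z * ψ z t) ζ := fun k =>
    hat hU ((htv1 k).mul (hψt.of_le h12)) hζ
  have hdtaψ : ∀ k β, DifferentiableAt ℝ (fun z => ta k β z * pd (fun r => ψ r t) z β) ζ :=
    fun k β => hat hU ((hta1 k β).mul (contDiffOn_pd hU hψt (by norm_num) β)) hζ
  have hdvφ : ∀ i, DifferentiableAt ℝ (fun q => v i q * φ q t) (x ζ) := fun i =>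
    hat hV ((hv i).mul (hφt.of_le h12)) (hxmaps hζ)
  have hdaφ : ∀ k j, DifferentiableAt ℝ (fun q => a k j q * pd (fun r => φ r t) q j) (x ζ) :=
    fun k j => hat hV (((ha k j).of_le h12).mul (contDiffOn_pd hV hφt (by norm_num) j))
      (hxmaps hζ)
  let F : Fin D → (Fin D → ℝ) → ℝ := fun α q =>
    v α q * φ q t - ∑ j, a α j q * pd (fun r => φ r t) q j
  have hF : ∀ α, DifferentiableAt ℝ (F α) (x ζ) := fun α =>
    (hdvφ α).sub (DifferentiableAt.fun_sum fun j _ => hdaφ α j)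
  have hpdF : ∀ α, pd (F α) (x ζ) α = pd (fun q => v α q * φ q t) (x ζ) α -
      ∑ j, pd (fun q => a α j q * pd (fun r => φ r t) q j) (x ζ) α := fun α => by
    rw [pd_sub (hdvφ α) (DifferentiableAt.fun_sum fun j _ => hdaφ α j), pd_sum fun j _ => hdaφ α j]
  have hflux : ∀ k, ∀ z ∈ U, tv k z * ψ z t - ∑ β, ta k β z * pd (fun r => ψ r t) z β =
      ∑ α, jdet x z * (jacobi x z)⁻¹ k α * F α (x z) := by
    intro k z hz
    have hdx : DifferentiableAt ℝ x z :=
      (hx.contDiffAt (hU.mem_nhds hz)).differentiableAt (by norm_num)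
    have hu : IsUnit (jacobi x z).det := isUnit_iff_ne_zero.2 (h0 z hz)
    have hgrad : ∀ j, ∑ β, (jacobi x z)⁻¹ β j * pd (fun y => φ (x y) t) z β =
        pd (fun q => φ q t) (x z) j := fun j => by
      simp_rw [pd_comp (g := fun q => φ q t) (hat hV (hφt.of_le h12) (hxmaps hz)) hdx,
        Finset.mul_sum]
      rw [Finset.sum_comm]
      have hone : ∀ i, ∑ β, (jacobi x z)⁻¹ β j * (pd (fun q => φ q t) (x z) i * jacobi x z i β) =
          pd (fun q => φ q t) (x z) i * (1 : Matrix (Fin D) (Fin D) ℝ) i j := fun i => by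
        rw [← Matrix.mul_nonsing_inv _ hu, Matrix.mul_apply, Finset.mul_sum]
        exact Finset.sum_congr rfl fun β _ => by ring
      simp_rw [hone, Matrix.one_apply]
      simp
    have hpdψ : ∀ β, pd (fun r => ψ r t) z β =
        jdet x z * (∑ γ, ∑ ρ, (jacobi x z)⁻¹ γ ρ * pd2 (fun z => x z ρ) z γ β) * φ (x z) t +
          jdet x z * pd (fun y => φ (x y) t) z β := fun β => by
      rw [← pd_jdet hU hx hz (h0 z hz), ← pd_mul (hat hU (hJ.of_le h12) hz)
        (hat hU (hφx.of_le h12) hz)]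
      exact pd_congr hU (fun y _ => hψ y t) hz β
    have hcorr : ∀ α, ∑ j, ∑ β, ∑ γ, ∑ ρ,
          a α j (x z) * (jacobi x z)⁻¹ k α * (jacobi x z)⁻¹ β j *
            ((jacobi x z)⁻¹ γ ρ * pd2 (fun z => x z ρ) z γ β) =
        ∑ j, ∑ β, a α j (x z) * (jacobi x z)⁻¹ k α * (jacobi x z)⁻¹ β j *
            ∑ γ, ∑ ρ, (jacobi x z)⁻¹ γ ρ * pd2 (fun z => x z ρ) z γ β := fun α => by
      simp only [Finset.mul_sum]
    have hdiff : ∑ β, ta k β z * pd (fun r => ψ r t) z β =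
        ∑ α, ∑ j, ∑ β, a α j (x z) * (jacobi x z)⁻¹ k α * (jacobi x z)⁻¹ β j *
          pd (fun r => ψ r t) z β := by
      simp_rw [hta, Finset.sum_mul]
      rw [Finset.sum_comm]
      exact Finset.sum_congr rfl fun α _ => Finset.sum_comm
    rw [hdiff, htv, hψ]
    simp_rw [hcorr]
    rw [add_mul, Finset.sum_mul, Finset.sum_mul, ← Finset.sum_add_distrib,
      ← Finset.sum_sub_distrib]
    refine Finset.sum_congr rfl fun α _ => ?_
    simp only [F]
    simp_rw [← hgrad]
    rw [mul_sub, add_sub_assoc, sub_eq_add_neg (_ * (v α (x z) * φ (x z) t))]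
    congr 1
    · ring
    · simp_rw [hpdψ, Finset.sum_mul (Finset.univ (α := Fin D))]
      rw [← Finset.sum_sub_distrib, Finset.mul_sum, ← Finset.sum_neg_distrib]
      refine Finset.sum_congr rfl fun j _ => ?_
      rw [← Finset.sum_sub_distrib, Finset.mul_sum, Finset.mul_sum, ← Finset.sum_neg_distrib]
      refine Finset.sum_congr rfl fun β _ => ?_
      ring
  have htime : deriv (ψ ζ) t = jdet x ζ * deriv (φ (x ζ)) t := by
    rw [funext (hψ ζ), deriv_const_mul_field]
  have hdiv := sum_pd_piola_transform hU hx hB h0 hζ hF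
  have hlhs : ∀ k, pd (fun z => ∑ α, jdet x z * (jacobi x z)⁻¹ k α * F α (x z)) ζ k =
      pd (fun z => tv k z * ψ z t) ζ k -
        ∑ β, pd (fun z => ta k β z * pd (fun r => ψ r t) z β) ζ k := fun k => by
    rw [← pd_congr hU (hflux k) hζ, pd_sub (hdtvψ k)
      (DifferentiableAt.fun_sum fun β _ => hdtaψ k β), pd_sum fun β _ => hdtaψ k β]
  simp_rw [hlhs, hpdF, Finset.sum_sub_distrib] at hdiv
  have := heq (x ζ) (hxmaps hζ) t
  rw [htime]
  linear_combination hdiv + jdet x ζ * this
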